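/- There is no Seidel matrix of order 18 whose spectrum is {−9 with multiplicity 3, 1 with multiplicity 9, 3 with multiplicity 6}. -/

import Mathlib

open Polynomial

/-- A Seidel matrix: a real symmetric matrix with zero diagonal and all off-diagonal
entries equal to `±1`. -/
def IsSeidel {m : Type*} (S : Matrix m m ℝ) : Prop :=
  S.IsSymm ∧ (∀ i, S i i = 0) ∧ ∀ i j, i ≠ j → S i j = 1 ∨ S i j = -1

theorem Matrix.IsHermitian.aeval_eq_conj_diagonal {n : Type*} [Fintype n] [DecidableEq n]
    {A : Matrix n n ℝ} (hA : A.IsHermitian) (p : ℝ[X]) :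
    aeval A p = (hA.eigenvectorUnitary : Matrix n n ℝ) *
      Matrix.diagonal (fun i => p.eval (hA.eigenvalues i)) *
      (star hA.eigenvectorUnitary : Matrix n n ℝ) := by
  conv_lhs => rw [hA.spectral_theorem]
  have h : ∀ B : Matrix n n ℝ,
      aeval (Unitary.conjStarAlgAut ℝ _ hA.eigenvectorUnitary B) p =
        Unitary.conjStarAlgAut ℝ _ hA.eigenvectorUnitary (aeval B p) := fun B =>
    Polynomial.aeval_algHom_apply
      (Unitary.conjStarAlgAut ℝ _ hA.eigenvectorUnitary).toAlgEquiv.toAlgHom B p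
  have hd : ∀ d : n → ℝ, aeval (Matrix.diagonal d) p =
      Matrix.diagonal (fun i => p.eval (d i)) := fun d => by
    have := Polynomial.aeval_algHom_apply (Matrix.diagonalAlgHom (n := n) (α := ℝ) ℝ) d p
    rw [Matrix.diagonalAlgHom_apply, Matrix.diagonalAlgHom_apply] at this
    rw [this]
    congr 1
    ext i
    simp
  rw [h, hd, Unitary.conjStarAlgAut_apply]
  rfl

theorem Matrix.IsHermitian.rank_aeval_le {n : Type*} [Fintype n] [DecidableEq n]
    {A : Matrix n n ℝ} (hA : A.IsHermitian) (p : ℝ[X]) :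
    (aeval A p).rank ≤ Fintype.card {i // p.eval (hA.eigenvalues i) ≠ 0} := by
  rw [hA.aeval_eq_conj_diagonal, ← Matrix.rank_diagonal]
  exact (Matrix.rank_mul_le_left _ _).trans (Matrix.rank_mul_le_right _ _)

theorem Matrix.det_submatrix_eq_zero_of_rank_lt {K m k : Type*} [Field K] [Fintype m] [Fintype k]
    [DecidableEq k] (A : Matrix m m K) (h : A.rank < Fintype.card k) (f : k → m) :
    (A.submatrix f f).det = 0 := by
  by_contra hd
  have h₁ := Matrix.rank_of_isUnit _
    ((Matrix.isUnit_iff_isUnit_det _).2 (isUnit_iff_ne_zero.2 hd))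
  have h₂ := A.rank_submatrix_le f f
  omega

section SeidelSpectrum

variable {S : Matrix (Fin 18) (Fin 18) ℝ}

theorem roots_prod_pow : ((X - C (-9)) ^ 3 * (X - C 1) ^ 9 * (X - C 3) ^ 6 : ℝ[X]).roots =
    3 • {-9} + 9 • {1} + 6 • {3} := by
  have h : ∀ (a : ℝ) (k : ℕ), ((X - C a) ^ k : ℝ[X]) ≠ 0 := fun a k =>
    pow_ne_zero _ (X_sub_C_ne_zero a)
  rw [roots_mul (mul_ne_zero (mul_ne_zero (h _ _) (h _ _)) (h _ _)),
    roots_mul (mul_ne_zero (h _ _) (h _ _))]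
  simp only [roots_pow, roots_X_sub_C]

theorem eigenvalues_multiset (hS : S.IsHermitian)
    (hc : S.charpoly = (X - C (-9)) ^ 3 * (X - C 1) ^ 9 * (X - C 3) ^ 6) :
    Multiset.map hS.eigenvalues Finset.univ.val = 3 • {-9} + 9 • {1} + 6 • {3} := by
  have := hS.roots_charpoly_eq_eigenvalues
  rw [hc, roots_prod_pow] at this
  simpa using this.symm

theorem eigenvalues_cases (hS : S.IsHermitian)
    (hc : S.charpoly = (X - C (-9)) ^ 3 * (X - C 1) ^ 9 * (X - C 3) ^ 6) (i : Fin 18) :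
    hS.eigenvalues i = -9 ∨ hS.eigenvalues i = 1 ∨ hS.eigenvalues i = 3 := by
  have h : hS.eigenvalues i ∈ Multiset.map hS.eigenvalues Finset.univ.val :=
    Multiset.mem_map_of_mem _ (Finset.mem_univ i)
  rw [eigenvalues_multiset hS hc] at h
  simpa [Multiset.mem_nsmul, or_assoc] using h

theorem card_eigenvalues_neg (hS : S.IsHermitian)
    (hc : S.charpoly = (X - C (-9)) ^ 3 * (X - C 1) ^ 9 * (X - C 3) ^ 6) :
    Fintype.card {i // hS.eigenvalues i = -9} = 3 := by
  classical
  have h := congrArg (Multiset.count (-9)) (eigenvalues_multiset hS hc)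
  rw [Multiset.count_map] at h
  rw [Fintype.card_subtype, Finset.card_def, Finset.filter_val]
  simp only [eq_comm (a := (-9 : ℝ))] at h
  rw [h]
  norm_num [Multiset.count_nsmul, Multiset.count_singleton]

theorem mul_quadratic_eq (hS : S.IsHermitian)
    (hc : S.charpoly = (X - C (-9)) ^ 3 * (X - C 1) ^ 9 * (X - C 3) ^ 6) :
    S * (S * S - (4 : ℝ) • S + (3 : ℝ) • 1) = (-9 : ℝ) • (S * S - (4 : ℝ) • S + (3 : ℝ) • 1) := by
  have h := hS.aeval_eq_conj_diagonal ((X - C (-9)) * (X * X - C 4 * X + C 3))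
  have h0 : (fun i => eval (hS.eigenvalues i) ((X - C (-9)) * (X * X - C 4 * X + C 3) : ℝ[X])) =
      0 := by
    ext i
    rcases eigenvalues_cases hS hc i with h | h | h <;> simp [h] <;> norm_num
  rw [h0] at h
  simp only [Pi.zero_def, Matrix.diagonal_zero, mul_zero, zero_mul, map_mul, map_sub, map_add,
    aeval_X, aeval_C, Algebra.algebraMap_eq_smul_one, smul_mul_assoc, one_mul, sub_mul] at h
  exact sub_eq_zero.1 h

theorem rank_quadratic_le (hS : S.IsHermitian)
    (hc : S.charpoly = (X - C (-9)) ^ 3 * (X - C 1) ^ 9 * (X - C 3) ^ 6) :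
    (S * S - (4 : ℝ) • S + (3 : ℝ) • 1).rank ≤ 3 := by
  classical
  have h := hS.rank_aeval_le (X * X - C 4 * X + C 3)
  have h' := h.trans (Fintype.card_subtype_mono _ (fun i => hS.eigenvalues i = -9) (by
    intro i hi
    rcases eigenvalues_cases hS hc i with h | h | h
    · exact h
    all_goals exact absurd (by simp [h]; norm_num) hi))
  rw [card_eigenvalues_neg hS hc] at h'
  simpa only [map_mul, map_sub, map_add, aeval_X, aeval_C, Algebra.algebraMap_eq_smul_one,
    smul_mul_assoc, one_mul] using h'

end SeidelSpectrum

theorem IsSeidel.exists_int_matrix {m : Type*} {S : Matrix m m ℝ} (hS : IsSeidel S) :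
    ∃ T : Matrix m m ℤ, T.map (Int.castRingHom ℝ) = S ∧ T.IsSymm ∧ (∀ i, T i i = 0) ∧
      ∀ i j, i ≠ j → T i j = 1 ∨ T i j = -1 := by
  obtain ⟨hs, hd, ho⟩ := hS
  have h : ∀ i j, ∃ t : ℤ, (t : ℝ) = S i j := fun i j => by
    by_cases hij : i = j
    · exact ⟨0, by simp [hij, hd]⟩
    · rcases ho i j hij with h | h
      · exact ⟨1, by simp [h]⟩
      · exact ⟨-1, by simp [h]⟩
  choose T hT using h
  refine ⟨Matrix.of T, ?_, ?_, ?_, ?_⟩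
  · ext i j
    simpa using hT i j
  · ext i j
    have := hs.apply i j
    rw [← hT, ← hT] at this
    exact_mod_cast this
  · intro i
    have := hd i
    rw [← hT] at this
    exact_mod_cast this
  · intro i j hij
    have := ho i j hij
    rw [← hT] at this
    exact_mod_cast this

theorem det_ne_zero_of_triple_products_eq (a b c d e f : ZMod 5) (ha : a = 2 ∨ a = 3)
    (hb : b = 2 ∨ b = 3) (hc : c = 2 ∨ c = 3) (hd : d = 2 ∨ d = 3) (he : e = 2 ∨ e = 3)
    (hf : f = 2 ∨ f = 3) (h₁ : a * b * d = a * c * e) (h₂ : a * b * d = b * c * f) :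
    (!![0, a, b, c; a, 0, d, e; b, d, 0, f; c, e, f, 0] : Matrix _ _ (ZMod 5)).det ≠ 0 := by
  rw [Matrix.det_succ_row_zero]
  simp [Matrix.det_fin_three, Fin.sum_univ_succ, Matrix.submatrix, Fin.succAbove]
  revert a b c d e f
  decide

theorem exists_three_eq (c : Fin 5 → Bool) :
    ∃ i j k : Fin 5, i ≠ j ∧ i ≠ k ∧ j ≠ k ∧ c i = c j ∧ c i = c k := by
  revert c; decide

theorem exists_monochromatic_triangle (c : Fin 6 → Fin 6 → Bool) :
    ∃ i j k : Fin 6, i ≠ j ∧ i ≠ k ∧ j ≠ k ∧ c i j = c i k ∧ c i j = c j k := by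
  obtain ⟨i, j, k, hij, hik, hjk, h₁, h₂⟩ := exists_three_eq fun i => c 0 i.succ
  have hs : ∀ {a b : Fin 5}, a ≠ b → a.succ ≠ b.succ := fun h h' => h (Fin.succ_injective _ h')
  have h0 : ∀ a : Fin 5, (0 : Fin 6) ≠ a.succ := fun a => (Fin.succ_ne_zero a).symm
  by_cases hd : c i.succ j.succ = c 0 i.succ
  · exact ⟨0, i.succ, j.succ, h0 _, h0 _, hs hij, h₁, hd.symm⟩
  by_cases he : c i.succ k.succ = c 0 i.succ
  · exact ⟨0, i.succ, k.succ, h0 _, h0 _, hs hik, h₂, he.symm⟩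
  by_cases hf : c j.succ k.succ = c 0 i.succ
  · exact ⟨0, j.succ, k.succ, h0 _, h0 _, hs hjk, h₁.symm.trans h₂, by rw [hf]; exact h₁.symm⟩
  · rw [← ne_eq, ← Bool.eq_not] at hd he hf
    exact ⟨i.succ, j.succ, k.succ, hs hij, hs hik, hs hjk, by rw [hd, he], by rw [hd, hf]⟩

/-- A graph of maximum degree at most one on `n` vertices has an independent set of every size
`k ≤ (n + 1) / 2`. -/
theorem exists_independent {n k : ℕ} (bad : Fin n → Fin n → Prop)
    (hsymm : ∀ i j, bad i j → bad j i) (huniq : ∀ i j k, bad i j → bad i k → j = k)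
    (hk : 2 * k ≤ n + 1) :
    ∃ f : Fin k → Fin n, Function.Injective f ∧ ∀ i j, i ≠ j → ¬ bad (f i) (f j) := by
  classical
  suffices h : ∀ m, 2 * m ≤ n + 1 → ∃ t : Finset (Fin n), t.card = m ∧
      ∀ i ∈ t, ∀ j ∈ t, i ≠ j → ¬ bad i j by
    obtain ⟨t, ht, hb⟩ := h k hk
    let e := (t.equivFinOfCardEq ht).symm
    exact ⟨fun i => e i, fun i j h => e.injective (Subtype.ext h), fun i j hij =>
      hb _ (e i).2 _ (e j).2 fun h => hij (e.injective (Subtype.ext h))⟩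
  intro m
  induction m with
  | zero => exact fun _ => ⟨∅, by simp⟩
  | succ m ih =>
    intro hm
    obtain ⟨t, ht, hb⟩ := ih (by omega)
    let g : Fin n → Fin n := fun i => if h : ∃ j, bad i j then h.choose else i
    have hg : ∀ i j, bad i j → g i = j := fun i j h => by
      have hex : ∃ j, bad i j := ⟨j, h⟩
      simp only [g, dif_pos hex]
      exact huniq _ _ _ hex.choose_spec h
    obtain ⟨v, hv⟩ : ∃ v, v ∉ t ∪ t.image g := by
      by_contra! hall
      have h₁ : (t ∪ t.image g).card = n := by
        rw [Finset.eq_univ_iff_forall.2 hall]; simp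
      have h₂ := Finset.card_union_le t (t.image g)
      have h₃ := Finset.card_image_le (s := t) (f := g)
      omega
    simp only [Finset.mem_union, Finset.mem_image, not_or, not_exists, not_and] at hv
    have hvt : ∀ i ∈ t, ¬ bad i v := fun i hi h => hv.2 i hi (hg i v h)
    refine ⟨insert v t, by rw [Finset.card_insert_of_notMem hv.1, ht], ?_⟩
    intro i hi j hj hij
    rcases Finset.mem_insert.1 hi with rfl | hi <;> rcases Finset.mem_insert.1 hj with rfl | hj
    · exact absurd rfl hij
    · exact fun h => hvt j hj (hsymm _ _ h)
    · exact hvt i ‹_›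
    · exact hb i hi j hj hij

theorem exists_det_ne_zero (K : Matrix (Fin 7) (Fin 7) (ZMod 5)) (hs : K.IsSymm)
    (hd : ∀ i, K i i = 0) (ho : ∀ i j, i ≠ j → K i j = 2 ∨ K i j = 3) :
    ∃ f : Fin 4 → Fin 7, (K.submatrix f f).det ≠ 0 := by
  have hcol : ∀ i j : Fin 6, i ≠ j → K 0 i.succ * K 0 j.succ * K i.succ j.succ = 2 ∨
      K 0 i.succ * K 0 j.succ * K i.succ j.succ = 3 := fun i j hij => by
    rcases ho 0 i.succ (Fin.succ_ne_zero i).symm with h₁ | h₁ <;>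
    rcases ho 0 j.succ (Fin.succ_ne_zero j).symm with h₂ | h₂ <;>
    rcases ho i.succ j.succ (fun h => hij (Fin.succ_injective _ h)) with h₃ | h₃ <;>
    rw [h₁, h₂, h₃] <;> decide
  obtain ⟨i, j, k, hij, hik, hjk, h₁, h₂⟩ := exists_monochromatic_triangle
    fun i j => decide (K 0 i.succ * K 0 j.succ * K i.succ j.succ = 2)
  have key : ∀ x y : ZMod 5, (x = 2 ∨ x = 3) → (y = 2 ∨ y = 3) →
      decide (x = 2) = decide (y = 2) → x = y := by decide
  have h₁ := key _ _ (hcol i j hij) (hcol i k hik) h₁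
  have h₂ := key _ _ (hcol i j hij) (hcol j k hjk) h₂
  have hz : ∀ i : Fin 6, K 0 i.succ = 2 ∨ K 0 i.succ = 3 :=
    fun i => ho _ _ (Fin.succ_ne_zero i).symm
  have hp : ∀ i j : Fin 6, i ≠ j → K i.succ j.succ = 2 ∨ K i.succ j.succ = 3 :=
    fun i j h => ho _ _ fun h' => h (Fin.succ_injective _ h')
  refine ⟨![0, i.succ, j.succ, k.succ], ?_⟩
  convert det_ne_zero_of_triple_products_eq _ _ _ _ _ _ (hz i) (hz j) (hz k)
    (hp i j hij) (hp i k hik) (hp j k hjk) h₁ h₂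
  ext a b
  fin_cases a <;> fin_cases b <;> simp [hd, hs.apply]

section IntegerSeidel

variable {T M : Matrix (Fin 18) (Fin 18) ℤ}

theorem four_dvd_quadratic (hsymm : T.IsSymm) (hd : ∀ i, T i i = 0)
    (ho : ∀ i j, i ≠ j → T i j = 1 ∨ T i j = -1) (hM : M = T * T - (4 : ℤ) • T + (3 : ℤ) • 1)
    (hsq : ∀ i, ∑ j, M i j ^ 2 = 2400) (i j : Fin 18) : 4 ∣ M i j := by
  let E : Matrix (Fin 18) (Fin 18) ℤ := T + 1
  have hE : ∀ i j, E i j = 1 ∨ E i j = -1 := fun i j => by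
    by_cases h : i = j
    · subst h; simp [E, hd]
    · simpa [E, h] using ho i j h
  have hEs : ∀ i j, E i j = E j i := fun i j => by
    simp [E, hsymm.apply i j, Matrix.one_apply, eq_comm]
  have hME : M = E * E - (6 : ℤ) • E + (8 : ℤ) • 1 := by
    rw [hM]; simp only [E]; noncomm_ring
  let e : Fin 18 → ℤ := fun i => ∑ k, E i k
  have he : ∀ i, 2 ∣ e i := fun i => by
    have h : 2 ∣ ∑ k, (E i k - 1) := Finset.dvd_sum fun k _ => by
      rcases hE i k with h | h <;> rw [h] <;> decide
    rw [Finset.sum_sub_distrib] at h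
    simp at h
    change 2 ∣ e i - 18 at h
    omega
  have hMe : ∀ i j, 4 ∣ M i j - (e i + e j) := fun i j => by
    have h : 4 ∣ ∑ k, (E i k * E k j - (E i k + E j k - 1)) := Finset.dvd_sum fun k _ => by
      rw [hEs k j]
      rcases hE i k with h | h <;> rcases hE j k with h' | h' <;> rw [h, h'] <;> decide
    rw [Finset.sum_sub_distrib, Finset.sum_sub_distrib, Finset.sum_add_distrib] at h
    simp at h
    change 4 ∣ _ - (e i + e j - 18) at h
    have hm : M i j = (∑ k, E i k * E k j) - 6 * E i j +
        8 * (1 : Matrix (Fin 18) (Fin 18) ℤ) i j := by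
      rw [hME]
      simp only [Matrix.add_apply, Matrix.sub_apply, Matrix.smul_apply, Matrix.mul_apply,
        smul_eq_mul]
    rcases hE i j with h' | h' <;> rw [h'] at hm <;> omega
  have hee : ∀ i j, 4 ∣ e i + e j := fun i j => by
    by_contra hne
    have h : 16 ∣ ∑ k, (M i k ^ 2 + M j k ^ 2 - 4) := Finset.dvd_sum fun k _ => by
      have hi := hMe i k
      have hj := hMe j k
      have h₁ := he i
      have h₂ := he j
      have h₃ := he k
      obtain ⟨a, ha⟩ : 2 ∣ M i k := by omega
      obtain ⟨b, hb⟩ : 2 ∣ M j k := by omega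
      rw [ha, hb]
      have hab : (a + b) % 2 = 1 := by omega
      obtain ⟨c, hc⟩ : ∃ c, b = 2 * c + 1 - a := ⟨(a + b) / 2, by omega⟩
      have : (2 * a) ^ 2 + (2 * b) ^ 2 - 4 = 8 * (a * (a - 1)) + 16 * (c * (c + 1) - a * c) := by
        rw [hc]; ring
      rw [this]
      have h2 := Int.even_mul_pred_self a
      obtain ⟨d, hd⟩ := h2
      rw [hd]
      exact ⟨d + (c * (c + 1) - a * c), by ring⟩
    rw [Finset.sum_sub_distrib, Finset.sum_add_distrib, hsq, hsq] at h
    norm_num at h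
  have h₁ := hMe i j
  have h₂ := hee i j
  omega

/-- With `M = 4 L`, each row of `L` satisfies `L i j = -2 T i j` or `-3 T i j` off the diagonal, up
to at most one exception. So `L` modulo `5` has a `4 × 4` principal minor which does not vanish. -/
theorem false_of_mul_quadratic_eq (hsymm : T.IsSymm) (hd : ∀ i, T i i = 0)
    (ho : ∀ i j, i ≠ j → T i j = 1 ∨ T i j = -1) (hM : M = T * T - (4 : ℤ) • T + (3 : ℤ) • 1)
    (hTM : T * M = (-9 : ℤ) • M)
    (hdet : ∀ f : Fin 4 → Fin 18, (M.submatrix f f).det = 0) : False := by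
  have hMs : M.IsSymm := by
    rw [hM]
    simp only [Matrix.IsSymm, Matrix.transpose_add, Matrix.transpose_sub, Matrix.transpose_smul,
      Matrix.transpose_mul, Matrix.transpose_one, hsymm.eq]
  have hMM : M * M = (120 : ℤ) • M := by
    have h : M * M = T * (T * M) - (4 : ℤ) • (T * M) + (3 : ℤ) • M := by
      conv_lhs => enter [1]; rw [hM]
      simp only [add_mul, sub_mul, smul_mul_assoc, one_mul, mul_assoc]
    rw [h, hTM, mul_smul_comm, hTM]
    module
  have hMd : ∀ i, M i i = 20 := fun i => by
    have h : ∑ k, T i k * T k i = 17 := by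
      have h' : ∀ k, T i k * T k i = 1 - if k = i then 1 else 0 := fun k => by
        by_cases hk : k = i
        · simp [hk, hd]
        · rw [← hsymm.apply i k]
          rcases ho k i hk with h | h <;> simp [h, hk]
      simp [h']
    rw [hM]
    simp only [Matrix.add_apply, Matrix.sub_apply, Matrix.smul_apply, Matrix.mul_apply, h, hd,
      Matrix.one_apply_eq]
    norm_num
  have hsq : ∀ i, ∑ j, M i j ^ 2 = 2400 := fun i => by
    have h := congrFun (congrFun hMM i) i
    simp only [Matrix.mul_apply, Matrix.smul_apply, hMd] at h
    simp only [sq]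
    simpa [hMs.apply] using h
  have hlin : ∀ i, ∑ j, M i j * T i j = -180 := fun i => by
    have h := congrFun (congrFun hTM i) i
    simp only [Matrix.mul_apply, Matrix.smul_apply, hMd] at h
    simpa [hMs.apply, mul_comm] using h
  choose L hL using four_dvd_quadratic hsymm hd ho hM hsq
  have hLs : ∀ i j, L i j = L j i := fun i j => by
    have := hMs.apply i j
    rw [hL, hL] at this
    omega
  have hLd : ∀ i, L i i = 5 := fun i => by
    have := hMd i
    rw [hL] at this
    omega
  let q : Fin 18 → Fin 18 → ℤ := fun i j => L i j ^ 2 + 5 * (L i j * T i j) + 6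
  have hqsum : ∀ i, ∑ j, q i j = 33 := fun i => by
    have h₁ := hsq i
    have h₂ := hlin i
    simp only [hL, mul_pow, mul_assoc, ← Finset.mul_sum] at h₁ h₂
    simp only [q, Finset.sum_add_distrib, ← Finset.mul_sum]
    simp
    omega
  have hfac : ∀ i j, i ≠ j → ∃ y, q i j = (y + 2) * (y + 3) ∧ L i j = y * T i j := by
    intro i j hij
    refine ⟨L i j * T i j, ?_⟩
    rcases ho i j hij with h | h <;> simp only [q, h] <;> constructor <;> ring
  have hnn : ∀ i j, 0 ≤ q i j := fun i j => by
    by_cases h : i = j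
    · subst h; simp [q, hLd, hd]
    · obtain ⟨y, hy, -⟩ := hfac i j h
      rw [hy]
      rcases le_or_gt (-2) y with h | h <;> nlinarith
  let bad : Fin 18 → Fin 18 → Prop := fun i j => i ≠ j ∧ q i j ≠ 0
  have hbad : ∀ i j, bad i j → 2 ≤ q i j := fun i j h => by
    obtain ⟨y, hy, -⟩ := hfac i j h.1
    have h₀ : 0 < q i j := lt_of_le_of_ne (hnn i j) (Ne.symm h.2)
    obtain ⟨d, hd⟩ := Int.even_mul_succ_self (y + 2)
    have : q i j = d + d := by rw [hy, ← hd]; ring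
    omega
  have hbs : ∀ i j, bad i j → bad j i := fun i j h => by
    refine ⟨h.1.symm, ?_⟩
    have := h.2
    simpa only [q, hLs j i, hsymm.apply i j] using this
  have huniq : ∀ i j k, bad i j → bad i k → j = k := fun i j k hj hk => by
    by_contra hjk
    have h := Finset.sum_le_sum_of_subset_of_nonneg (Finset.subset_univ {i, j, k})
      (fun l _ _ => hnn i l)
    rw [hqsum, Finset.sum_insert (by simp [hj.1, hk.1]), Finset.sum_pair hjk] at h
    have h₁ := hbad i j hj
    have h₂ := hbad i k hk
    have h₃ : q i i = 31 := by simp [q, hLd, hd]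
    omega
  obtain ⟨g, hg, hgb⟩ := exists_independent (k := 7) bad hbs huniq (by norm_num)
  let K : Matrix (Fin 7) (Fin 7) (ZMod 5) := Matrix.of fun i j => (L (g i) (g j) : ZMod 5)
  obtain ⟨f, hf⟩ := exists_det_ne_zero K (by ext i j; simp [K, hLs (g i) (g j)])
    (fun i => by simp [K, hLd]; decide) (fun i j hij => by
      have hne : g i ≠ g j := fun h => hij (hg h)
      have hq : q (g i) (g j) = 0 := by
        by_contra h
        exact hgb i j hij ⟨hne, h⟩
      obtain ⟨y, hy, hLy⟩ := hfac _ _ hne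
      rw [hq, eq_comm, mul_eq_zero] at hy
      have : L (g i) (g j) = -2 ∨ L (g i) (g j) = 2 ∨ L (g i) (g j) = -3 ∨ L (g i) (g j) = 3 := by
        rcases ho _ _ hne with h | h <;> rw [h] at hLy <;> omega
      simp only [K, Matrix.of_apply]
      rcases this with h | h | h | h <;> rw [h] <;> decide)
  apply hf
  have h4 := hdet (g ∘ f)
  have hM4 : M.submatrix (g ∘ f) (g ∘ f) = (4 : ℤ) • (Matrix.of L).submatrix (g ∘ f) (g ∘ f) := by
    ext i j
    simp [hL]
  rw [hM4, Matrix.det_smul] at h4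
  have h5 : ((Matrix.of L).submatrix (g ∘ f) (g ∘ f)).det = 0 := by simpa using h4
  have h6 := congrArg (Int.castRingHom (ZMod 5)) h5
  rw [RingHom.map_det, map_zero] at h6
  exact h6
end IntegerSeidel

/-- There is no Seidel matrix of order `18` whose spectrum is
`{−9 with multiplicity 3, 1 with multiplicity 9, 3 with multiplicity 6}`. -/
theorem stmt_13 :
    ¬ ∃ S : Matrix (Fin 18) (Fin 18) ℝ, IsSeidel S ∧
      S.charpoly = (X - C (-9)) ^ 3 * (X - C 1) ^ 9 * (X - C 3) ^ 6 := by
  rintro ⟨S, hS, hc⟩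
  have hH : S.IsHermitian := hS.1
  obtain ⟨T, hT, hsymm, hd, ho⟩ := hS.exists_int_matrix
  let φ := (Int.castRingHom ℝ).mapMatrix (m := Fin 18)
  have hφ : Function.Injective φ := Matrix.map_injective Int.cast_injective
  have hφT : φ T = S := hT
  have hsmul : ∀ (a : ℤ) (A : Matrix (Fin 18) (Fin 18) ℤ), φ (a • A) = (a : ℝ) • φ A :=
    fun a A => by ext i j; simp [φ, -zsmul_eq_mul]
  have hφM : φ (T * T - (4 : ℤ) • T + (3 : ℤ) • 1) = S * S - (4 : ℝ) • S + (3 : ℝ) • 1 := by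
    simp only [map_add, map_sub, map_mul, hsmul, map_one, hφT, Int.cast_ofNat]
  refine false_of_mul_quadratic_eq hsymm hd ho rfl (hφ ?_) fun f => ?_
  · rw [map_mul, hsmul, hφM, hφT, mul_quadratic_eq hH hc]
    norm_num
  · apply Int.cast_injective (α := ℝ)
    have h := Matrix.det_submatrix_eq_zero_of_rank_lt (k := Fin 4) _
      ((rank_quadratic_le hH hc).trans_lt (by simp)) f
    rw [← hφM] at h
    rw [Int.cast_zero, ← h]
    exact RingHom.map_det (Int.castRingHom ℝ) _
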